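/- (Theorem 1.3, version for ỹ and q̃.) For every γ > 1 and all positive constants Z_U, M₁, M₂, M₃, M₄ there exists a constant Ñ > 0, depending only on γ, Z_U, M₁, M₂, M₃, M₄, with the following property: there is no C² solution (u,z,m) of the system on all of [0,∞) × ℝ that satisfies 0 < z < Z_U, M₁ < m < M₂, |m_x| < M₃ and |m_xx| < M₄ everywhere, has z bounded away from 0 (i.e. z > Z_L for some Z_L > 0), and for which ỹ(0,x*) < −Ñ or q̃(0,x*) < −Ñ at some point x* ∈ ℝ. Equivalently, for any globally defined smooth solution with these bounds, the initial data satisfy ỹ(0,x) ≥ −Ñ and q̃(0,x) ≥ −Ñ for all x. -/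

import Mathlib

open Real

/-- Partial derivative with respect to `t` (the first coordinate). -/
noncomputable def pdt (f : ℝ × ℝ → ℝ) (pt : ℝ × ℝ) : ℝ := fderiv ℝ f pt (1, 0)

/-- Partial derivative with respect to `x` (the second coordinate). -/
noncomputable def pdx (f : ℝ × ℝ → ℝ) (pt : ℝ × ℝ) : ℝ := fderiv ℝ f pt (0, 1)

section PartialDerivatives

lemma fderiv_apply_eq_pdt_pdx (f : ℝ × ℝ → ℝ) (pt : ℝ × ℝ) (v : ℝ) :
    fderiv ℝ f pt (1, v) = pdt f pt + v * pdx f pt := by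
  have h : ((1, v) : ℝ × ℝ) = (1, 0) + v • (0, 1) := by simp
  rw [h, map_add, map_smul, smul_eq_mul, pdt, pdx]

lemma hasDerivWithinAt_comp_graph {f : ℝ × ℝ → ℝ} {X : ℝ → ℝ} {S : Set ℝ} {t v : ℝ}
    (hf : DifferentiableAt ℝ f (t, X t)) (hX : HasDerivWithinAt X v S t) :
    HasDerivWithinAt (fun s => f (s, X s)) (pdt f (t, X t) + v * pdx f (t, X t)) S t := by
  rw [← fderiv_apply_eq_pdt_pdx]
  exact hf.hasFDerivAt.comp_hasDerivWithinAt (f := fun s => (s, X s)) t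
    ((hasDerivWithinAt_id t S).prodMk hX)

lemma hasDerivAt_snd {f : ℝ × ℝ → ℝ} {t x : ℝ} (hf : DifferentiableAt ℝ f (t, x)) :
    HasDerivAt (fun s => f (t, s)) (pdx f (t, x)) x :=
  hf.hasFDerivAt.comp_hasDerivAt (f := fun s => (t, s)) x
    ((hasDerivAt_const x t).prodMk (hasDerivAt_id x))

variable {f : ℝ × ℝ → ℝ} {pt : ℝ × ℝ}

lemma differentiableAt_fderiv (hf : ContDiffAt ℝ 2 f pt) :
    DifferentiableAt ℝ (fderiv ℝ f) pt :=
  (hf.fderiv_right (m := 1) (by norm_num)).differentiableAt (by norm_num)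

lemma differentiableAt_pdx (hf : ContDiffAt ℝ 2 f pt) : DifferentiableAt ℝ (pdx f) pt :=
  (differentiableAt_fderiv hf).clm_apply (differentiableAt_const _)

lemma differentiableAt_pdt (hf : ContDiffAt ℝ 2 f pt) : DifferentiableAt ℝ (pdt f) pt :=
  (differentiableAt_fderiv hf).clm_apply (differentiableAt_const _)

lemma pdt_pdx_comm (hf : ContDiffAt ℝ 2 f pt) : pdt (pdx f) pt = pdx (pdt f) pt := by
  have key : ∀ v w : ℝ × ℝ, fderiv ℝ (fun p => fderiv ℝ f p v) pt w
      = fderiv ℝ (fderiv ℝ f) pt w v := fun v w => by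
    rw [fderiv_clm_apply (differentiableAt_fderiv hf) (differentiableAt_const _)]
    simp
  have h := hf.isSymmSndFDerivAt (by simp) (1, 0) (0, 1)
  rw [← key, ← key] at h
  exact h

end PartialDerivatives

/-- A continuously differentiable vector field that is bounded on `[0, ∞) × ℝ` has integral
curves on every time interval `[0, T]`. -/
lemma exists_integralCurve_of_bounded {v : ℝ × ℝ → ℝ} {L T : ℝ} (hT : 0 ≤ T)
    (hv : ∀ pt : ℝ × ℝ, 0 ≤ pt.1 → ContDiffAt ℝ 1 v pt)
    (hL : ∀ pt : ℝ × ℝ, 0 ≤ pt.1 → |v pt| ≤ L) (x : ℝ) :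
    ∃ X : ℝ → ℝ, X 0 = x ∧
      ∀ t ∈ Set.Icc 0 T, HasDerivWithinAt X (v (t, X t)) (Set.Icc 0 T) t := by
  have hL0 : 0 ≤ L := (abs_nonneg _).trans (hL (0, 0) le_rfl)
  set R : Set (ℝ × ℝ) := Set.Icc 0 T ×ˢ Metric.closedBall x (L * T)
  have hRc : IsCompact R := isCompact_Icc.prod (isCompact_closedBall _ _)
  have hloc : LocallyLipschitzOn R v := by
    intro pt hpt
    obtain ⟨K, s, hs, hK⟩ := (hv pt hpt.1.1).exists_lipschitzOnWith
    exact ⟨K, s, mem_nhdsWithin_of_mem_nhds hs, hK⟩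
  obtain ⟨K, hK⟩ := hloc.exists_lipschitzOnWith_of_compact hRc
  have hpl : IsPicardLindelof (fun t y => v (t, y)) (tmin := 0) (tmax := T)
      ⟨0, le_rfl, hT⟩ x ⟨L * T, mul_nonneg hL0 hT⟩ 0 ⟨L, hL0⟩ K :=
    { lipschitzOnWith := by
        intro t ht y hy y' hy'
        have h := hK (x := (t, y)) ⟨ht, hy⟩ (y := (t, y')) ⟨ht, hy'⟩
        simpa [Prod.edist_eq] using h
      continuousOn := by
        intro y hy
        exact hloc.continuousOn.comp (f := fun t => (t, y)) (by fun_prop)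
          fun t ht => ⟨ht, hy⟩
      norm_le := fun t ht y _ => hL (t, y) ht.1
      mul_max_le := by
        simp only [sub_zero, sub_self, max_eq_left hT, NNReal.coe_zero]
        exact le_rfl }
  exact hpl.exists_eq_forall_mem_Icc_hasDerivWithinAt₀

/-- Solutions of the differential inequality `f' ≤ -δ f²` below the level `-N` blow up
in finite time. -/
lemma not_lt_of_riccati_le {f f' : ℝ → ℝ} {δ N : ℝ} (hδ : 0 < δ) (hN : 0 < N)
    (hf : ∀ t ∈ Set.Icc 0 (2 / (δ * N)),
      HasDerivWithinAt f (f' t) (Set.Icc 0 (2 / (δ * N))) t)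
    (hf' : ∀ t ∈ Set.Icc 0 (2 / (δ * N)), f t ≤ -N → f' t ≤ -(δ * f t ^ 2)) :
    ¬ f 0 < -N := by
  intro h0
  set T := 2 / (δ * N) with hTdef
  have hT : 0 < T := by positivity
  have hcont : ContinuousOn f (Set.Icc 0 T) := fun t ht => (hf t ht).continuousWithinAt
  obtain ⟨C, hC⟩ := (isCompact_Icc.image_of_continuousOn hcont).bddBelow
  set M := max 0 (-C) + N + 1
  have hMN : N < M := by
    have := le_max_left 0 (-C)
    linarith
  have hMC : -M < C := by
    have := le_max_right 0 (-C)
    linarith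
  have hM0 : 0 < M := hN.trans hMN
  set S := 2 / δ * (1 / N - 1 / M) with hS
  have hinv : 1 / M < 1 / N := one_div_lt_one_div_of_lt hN hMN
  have hS0 : 0 ≤ S := mul_nonneg (by positivity) (by linarith)
  have hST : S ≤ T := by
    have : T - S = 2 / δ * (1 / M) := by
      rw [hTdef, hS]; field_simp; ring
    have : 0 < 2 / δ * (1 / M) := by positivity
    linarith
  have hden : ∀ t ∈ Set.Icc 0 S, 0 < 1 / N - δ / 2 * t := by
    intro t ht
    have h1 : δ / 2 * t ≤ δ / 2 * S := mul_le_mul_of_nonneg_left ht.2 (by positivity)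
    have h2 : δ / 2 * S = 1 / N - 1 / M := by rw [hS]; field_simp
    have h3 : 0 < 1 / M := by positivity
    linarith
  set B : ℝ → ℝ := fun t => -(1 / N - δ / 2 * t)⁻¹ with hB
  have hBd : ∀ t ∈ Set.Icc 0 S, HasDerivAt B (-(δ / 2 * B t ^ 2)) t := by
    intro t ht
    have h1 : HasDerivAt (fun t => 1 / N - δ / 2 * t) (-(δ / 2 * 1)) t :=
      ((hasDerivAt_id t).const_mul (δ / 2)).const_sub (1 / N)
    refine (h1.fun_inv (hden t ht).ne').fun_neg.congr_deriv ?_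
    have := (hden t ht).ne'
    simp only [hB]
    field_simp
  have hBN : ∀ t ∈ Set.Icc 0 S, B t ≤ -N := by
    intro t ht
    have h1 : 1 / N - δ / 2 * t ≤ N⁻¹ := by
      have : 0 ≤ δ / 2 * t := mul_nonneg (by positivity) ht.1
      rw [one_div]; linarith
    have h2 := (le_inv_comm₀ (hden t ht) hN).1 h1
    simp only [hB]
    linarith
  have hle := image_le_of_deriv_right_lt_deriv_boundary' (f := f) (f' := f') (a := 0) (b := S)
    (B := B) (B' := fun t => -(δ / 2 * B t ^ 2))
    (hcont.mono (Set.Icc_subset_Icc_right hST))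
    (fun t ht => (hf t ⟨ht.1, ht.2.le.trans hST⟩).mono_of_mem_nhdsWithin
      (Icc_mem_nhdsGE_of_mem ⟨ht.1, ht.2.trans_le hST⟩))
    (by simp [hB]; linarith)
    (fun t ht => (hBd t ht).continuousAt.continuousWithinAt)
    (fun t ht => (hBd t ⟨ht.1, ht.2.le⟩).hasDerivWithinAt)
    (fun t ht heq => by
      have ht' : t ∈ Set.Icc 0 S := ⟨ht.1, ht.2.le⟩
      have hBt := hBN t ht'
      have h1 := hf' t ⟨ht.1, ht'.2.trans hST⟩ (heq ▸ hBt)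
      rw [heq] at h1
      have h2 : 0 < B t ^ 2 := by
        have : B t ≠ 0 := by linarith
        positivity
      nlinarith)
    (x := S) ⟨hS0, le_rfl⟩
  have hBS : B S = -M := by
    simp only [hB, hS]
    rw [show 1 / N - δ / 2 * (2 / δ * (1 / N - 1 / M)) = M⁻¹ by field_simp; ring, inv_inv]
  have := hC ⟨S, ⟨hS0, hST⟩, rfl⟩
  linarith

/-- The weighted gradient variables of the Euler system: `σ = 1` and `σ = -1` correspond to the
forward and the backward characteristic family. -/
noncomputable def weightedGradient (e k d σ : ℝ) (u z m : ℝ × ℝ → ℝ) (pt : ℝ × ℝ) : ℝ :=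
  z pt ^ e * (pdx u pt + σ * (m pt * pdx z pt) + σ * (k * pdx m pt * z pt))
    + σ * (d * z pt ^ (e + 1) * pdx m pt)

lemma hasDerivWithinAt_rpow_div {z : ℝ → ℝ} {z' t e : ℝ} {S : Set ℝ}
    (hz : HasDerivWithinAt z z' S t) (h0 : 0 < z t) :
    HasDerivWithinAt (fun s => z s ^ e) (e * (z t ^ e / z t) * z') S t := by
  convert hz.rpow_const (p := e) (Or.inl h0.ne') using 1
  rw [Real.rpow_sub_one h0.ne']
  ring

/-- The quadratic term dominates in the Riccati right-hand side below a suitable level. -/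
lemma riccati_rhs_le {A B a b e y : ℝ} (he : 0 < e) (ha : |a| ≤ A) (hb : |b| ≤ B)
    (hy : y ≤ -(1 + 4 * (A + B) / e)) : a + b * y - e * y ^ 2 ≤ -(e / 2 * y ^ 2) := by
  have hA : 0 ≤ A := (abs_nonneg a).trans ha
  have hB : 0 ≤ B := (abs_nonneg b).trans hb
  obtain ⟨w, rfl⟩ : ∃ w, y = -w := ⟨-y, by ring⟩
  have hq : 0 ≤ 4 * (A + B) / e := by positivity
  have hw1 : 1 ≤ w := by linarith
  have hw : 4 * (A + B) ≤ e * w := by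
    have : 4 * (A + B) / e ≤ w := by linarith
    rw [div_le_iff₀ he] at this
    linarith
  have h1 : a ≤ A * w := by nlinarith [le_abs_self a]
  have h2 : b * -w ≤ B * w := by nlinarith [neg_abs_le b]
  nlinarith

section Riccati

variable {u z m : ℝ × ℝ → ℝ} {e k d Kc : ℝ}
  (hu : ∀ pt : ℝ × ℝ, 0 ≤ pt.1 → ContDiffAt ℝ 2 u pt)
  (hz : ∀ pt : ℝ × ℝ, 0 ≤ pt.1 → ContDiffAt ℝ 2 z pt)
  (hm : ∀ pt : ℝ × ℝ, 0 ≤ pt.1 → ContDiffAt ℝ 2 m pt)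
  (hz0 : ∀ pt : ℝ × ℝ, 0 ≤ pt.1 → 0 < z pt)
  (hzt : ∀ pt : ℝ × ℝ, 0 ≤ pt.1 → pdt z pt = -(Kc * (z pt ^ e) ^ 2 * pdx u pt))
  (hut : ∀ pt : ℝ × ℝ, 0 ≤ pt.1 → pdt u pt = -(Kc * (z pt ^ e) ^ 2 *
    (m pt ^ 2 * pdx z pt + k * (m pt * z pt * pdx m pt))))
  (hmt : ∀ pt : ℝ × ℝ, 0 ≤ pt.1 → pdt m pt = 0)

include hm hmt in
lemma pdt_pdx_m {t x : ℝ} (ht : 0 ≤ t) : pdt (pdx m) (t, x) = 0 := by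
  rw [pdt_pdx_comm (hm _ ht)]
  refine (hasDerivAt_snd (differentiableAt_pdt (hm (t, x) ht))).unique ?_
  simp only [hmt (t, _) ht]
  exact hasDerivAt_const x 0

include hu hz hz0 hzt in
lemma pdt_pdx_z {t x : ℝ} (ht : 0 ≤ t) : pdt (pdx z) (t, x) =
    -(Kc * (z (t, x) ^ e) ^ 2 * (2 * e / z (t, x) * pdx z (t, x) * pdx u (t, x)
      + pdx (pdx u) (t, x))) := by
  rw [pdt_pdx_comm (hz _ ht)]
  refine (hasDerivAt_snd (differentiableAt_pdt (hz (t, x) ht))).unique ?_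
  simp only [hzt (t, _) ht]
  have hz1 := (hasDerivAt_snd ((hz (t, x) ht).differentiableAt (by norm_num))).hasDerivWithinAt
    (s := Set.univ)
  have hP := (hasDerivWithinAt_rpow_div (e := e) hz1 (hz0 _ ht)).hasDerivAt Filter.univ_mem
  have hux := hasDerivAt_snd (differentiableAt_pdx (hu (t, x) ht))
  refine ((((hP.fun_pow 2).const_mul Kc).fun_mul hux).fun_neg).congr_deriv ?_
  have := (hz0 (t, x) ht).ne'
  push_cast
  field_simp

include hu hz hm hz0 hut in
lemma pdt_pdx_u {t x : ℝ} (ht : 0 ≤ t) : pdt (pdx u) (t, x) =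
    -(Kc * (z (t, x) ^ e) ^ 2 * (2 * e / z (t, x) * pdx z (t, x) *
        (m (t, x) ^ 2 * pdx z (t, x) + k * (m (t, x) * z (t, x) * pdx m (t, x)))
      + (2 * m (t, x) * pdx m (t, x) * pdx z (t, x) + m (t, x) ^ 2 * pdx (pdx z) (t, x)
        + k * (pdx m (t, x) * z (t, x) * pdx m (t, x) + m (t, x) * pdx z (t, x) * pdx m (t, x)
          + m (t, x) * z (t, x) * pdx (pdx m) (t, x))))) := by
  rw [pdt_pdx_comm (hu _ ht)]
  refine (hasDerivAt_snd (differentiableAt_pdt (hu (t, x) ht))).unique ?_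
  simp only [hut (t, _) ht]
  have hz1 := hasDerivAt_snd ((hz (t, x) ht).differentiableAt (by norm_num))
  have hm1 := hasDerivAt_snd ((hm (t, x) ht).differentiableAt (by norm_num))
  have hP := (hasDerivWithinAt_rpow_div (e := e) (hz1.hasDerivWithinAt (s := Set.univ))
    (hz0 _ ht)).hasDerivAt Filter.univ_mem
  have hzx := hasDerivAt_snd (differentiableAt_pdx (hz (t, x) ht))
  have hmx := hasDerivAt_snd (differentiableAt_pdx (hm (t, x) ht))
  refine ((((hP.fun_pow 2).const_mul Kc).fun_mul (((hm1.fun_pow 2).fun_mul hzx).fun_add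
    (((hm1.fun_mul hz1).fun_mul hmx).const_mul k))).fun_neg).congr_deriv ?_
  have := (hz0 (t, x) ht).ne'
  push_cast
  field_simp

include hu hz hm hz0 hzt hut hmt in
/-- The Riccati equation of the weighted gradient along a characteristic. -/
lemma hasDerivWithinAt_weightedGradient (hd : 2 * d * (e + 1) = 1 - k) {σ : ℝ}
    (hσ : σ = 1 ∨ σ = -1) {X : ℝ → ℝ} {S : Set ℝ} {t : ℝ} (ht : 0 ≤ t)
    (hX : HasDerivWithinAt X (σ * (Kc * m (t, X t) * (z (t, X t) ^ e) ^ 2)) S t) :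
    HasDerivWithinAt (fun s => weightedGradient e k d σ u z m (s, X s))
      (Kc * (z (t, X t) ^ e / z (t, X t)) *
        ((z (t, X t) ^ e * z (t, X t)) ^ 2 *
            (d * (m (t, X t) * pdx (pdx m) (t, X t)) + ((k + d) ^ 2 - k) * pdx m (t, X t) ^ 2)
          + (k + d) * (e - 1) * (σ * pdx m (t, X t)) * (z (t, X t) ^ e * z (t, X t)) *
            weightedGradient e k d σ u z m (t, X t)
          - e * weightedGradient e k d σ u z m (t, X t) ^ 2)) S t := by
  have hzp := hz0 (t, X t) ht
  have hz1 := hasDerivWithinAt_comp_graph ((hz (t, X t) ht).differentiableAt (by norm_num)) hX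
  have hm1 := hasDerivWithinAt_comp_graph ((hm (t, X t) ht).differentiableAt (by norm_num)) hX
  have hux := hasDerivWithinAt_comp_graph (differentiableAt_pdx (hu (t, X t) ht)) hX
  have hzx := hasDerivWithinAt_comp_graph (differentiableAt_pdx (hz (t, X t) ht)) hX
  have hmx := hasDerivWithinAt_comp_graph (differentiableAt_pdx (hm (t, X t) ht)) hX
  have hP := hasDerivWithinAt_rpow_div (e := e) hz1 hzp
  have hQ := hasDerivWithinAt_rpow_div (e := e + 1) hz1 hzp
  refine ((hP.fun_mul ((hux.fun_add ((hm1.fun_mul hzx).const_mul σ)).fun_add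
    (((hmx.const_mul k).fun_mul hz1).const_mul σ))).fun_add
      (((hQ.const_mul d).fun_mul hmx).const_mul σ)).congr_deriv ?_
  rw [pdt_pdx_m hm hmt ht, pdt_pdx_z hu hz hz0 hzt ht, pdt_pdx_u hu hz hm hz0 hut ht,
    hzt _ ht, hmt _ ht]
  have hk : k = 1 - 2 * d * (e + 1) := by linarith
  simp only [weightedGradient, Real.rpow_add_one hzp.ne']
  generalize z (t, X t) ^ e = P at *
  subst hk
  rcases hσ with rfl | rfl
  · simp
    field_simp
    ring
  · simp
    field_simp
    ring

include hu hz hm hzt hut hmt in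
/-- The weighted gradients of a global solution are bounded below. -/
lemma neg_le_weightedGradient {ZL ZU M1 M2 M3 M4 σ : ℝ} (he : 0 < e)
    (hd : 2 * d * (e + 1) = 1 - k) (hσ : σ = 1 ∨ σ = -1) (hKc : 0 < Kc) (hZL : 0 < ZL)
    (hM1 : 0 < M1)
    (hb : ∀ pt : ℝ × ℝ, 0 ≤ pt.1 → ZL < z pt ∧ z pt < ZU ∧ M1 < m pt ∧ m pt < M2 ∧
      |pdx m pt| < M3 ∧ |pdx (pdx m) pt| < M4) (x : ℝ) :
    -(1 + 4 * ((ZU ^ e * ZU) ^ 2 * (|d| * (M2 * M4) + |(k + d) ^ 2 - k| * M3 ^ 2)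
      + |(k + d) * (e - 1)| * M3 * (ZU ^ e * ZU)) / e)
      ≤ weightedGradient e k d σ u z m (0, x) := by
  set A := (ZU ^ e * ZU) ^ 2 * (|d| * (M2 * M4) + |(k + d) ^ 2 - k| * M3 ^ 2) with hA
  set B := |(k + d) * (e - 1)| * M3 * (ZU ^ e * ZU) with hB
  obtain ⟨b1, b2, b3, b4, b5, b6⟩ := hb (0, 0) le_rfl
  have hZU : 0 < ZU := hZL.trans (b1.trans b2)
  have hM2 : 0 < M2 := hM1.trans (b3.trans b4)
  have hM3 : 0 < M3 := (abs_nonneg _).trans_lt b5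
  have hM4 : 0 < M4 := (abs_nonneg _).trans_lt b6
  clear b1 b2 b3 b4 b5 b6
  have hA0 : 0 ≤ A := by positivity
  have hB0 : 0 ≤ B := by positivity
  have hz0 : ∀ pt : ℝ × ℝ, 0 ≤ pt.1 → 0 < z pt := fun pt h => hZL.trans (hb pt h).1
  have hm0 : ∀ pt : ℝ × ℝ, 0 ≤ pt.1 → 0 < m pt := fun pt h => hM1.trans (hb pt h).2.2.1
  have hPU : ∀ pt : ℝ × ℝ, 0 ≤ pt.1 → z pt ^ e ≤ ZU ^ e := fun pt h =>
    Real.rpow_le_rpow (hz0 pt h).le (hb pt h).2.1.le he.le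
  have hPL : ∀ pt : ℝ × ℝ, 0 ≤ pt.1 → ZL ^ e ≤ z pt ^ e := fun pt h =>
    Real.rpow_le_rpow hZL.le (hb pt h).1.le he.le
  have hσ1 : |σ| = 1 := by rcases hσ with rfl | rfl <;> simp
  set δ := e / 2 * (Kc * (ZL ^ e / ZU)) with hδdef
  have hδ : 0 < δ := by positivity
  set N := 1 + 4 * (A + B) / e with hN
  have hN0 : 0 < N := by positivity
  obtain ⟨X, hX0, hX⟩ := exists_integralCurve_of_bounded
    (v := fun pt => σ * (Kc * m pt * (z pt ^ e) ^ 2)) (L := Kc * M2 * (ZU ^ e) ^ 2)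
    (T := 2 / (δ * N)) (by positivity)
    (fun pt h => contDiffAt_const.mul
      ((contDiffAt_const.mul ((hm pt h).of_le (by norm_num))).mul
        ((((hz pt h).of_le (by norm_num)).rpow_const_of_ne (hz0 pt h).ne').pow 2)))
    (fun pt h => by
      have h1 := hm0 pt h
      have h2 := Real.rpow_pos_of_pos (hz0 pt h) e
      have h3 := (hb pt h).2.2.2.1
      have h4 := hPU pt h
      rw [abs_mul, hσ1, one_mul, abs_of_pos (by positivity)]
      gcongr) x
  rw [← hX0, ← not_lt]
  refine not_lt_of_riccati_le (f := fun s => weightedGradient e k d σ u z m (s, X s)) hδ hN0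
    (fun t ht => hasDerivWithinAt_weightedGradient hu hz hm hz0 hzt hut hmt hd hσ ht.1 (hX t ht))
    fun t ht hy => ?_
  generalize weightedGradient e k d σ u z m (t, X t) = y at hy ⊢
  have ht0 : 0 ≤ ((t, X t) : ℝ × ℝ).1 := ht.1
  obtain ⟨b1, b2, b3, b4, b5, b6⟩ := hb _ ht0
  have hzp := hz0 _ ht0
  have hmp := hm0 _ ht0
  have hP := hPU _ ht0
  have hP' := hPL _ ht0
  have hPp := Real.rpow_pos_of_pos hzp e
  set pt : ℝ × ℝ := (t, X t)
  have ha : |(z pt ^ e * z pt) ^ 2 *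
      (d * (m pt * pdx (pdx m) pt) + ((k + d) ^ 2 - k) * pdx m pt ^ 2)| ≤ A := by
    rw [abs_mul, abs_of_pos (by positivity : 0 < (z pt ^ e * z pt) ^ 2), hA]
    gcongr
    refine (abs_add_le _ _).trans ?_
    rw [abs_mul, abs_mul, abs_mul, abs_of_pos hmp, abs_pow]
    gcongr
  have hb' : |(k + d) * (e - 1) * (σ * pdx m pt) * (z pt ^ e * z pt)| ≤ B := by
    rw [abs_mul, abs_mul, abs_mul σ, hσ1, one_mul,
      abs_of_pos (by positivity : 0 < z pt ^ e * z pt), hB]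
    gcongr
  have hrhs := riccati_rhs_le he ha hb' hy
  have hw : ZL ^ e / ZU ≤ z pt ^ e / z pt := by gcongr
  have hw0 : 0 < Kc * (z pt ^ e / z pt) := by positivity
  calc _ ≤ Kc * (z pt ^ e / z pt) * (-(e / 2 * y ^ 2)) :=
        mul_le_mul_of_nonneg_left hrhs hw0.le
    _ = -(e / 2 * (Kc * (z pt ^ e / z pt)) * y ^ 2) := by ring
    _ ≤ _ := by
        rw [hδdef]
        gcongr

end Riccati

/-- Theorem 1.3 (version for `ỹ` and `q̃`): there is `Ñ > 0`, depending only on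
`γ, Z_U, M₁, M₂, M₃, M₄`, such that every globally defined smooth solution on
`[0,∞) × ℝ` with the stated bounds satisfies `ỹ(0,x) ≥ −Ñ` and `q̃(0,x) ≥ −Ñ`
for all `x`. -/
theorem stmt_14 (γ : ℝ) (hγ : 1 < γ)
    (ZU M1 M2 M3 M4 : ℝ) (hZU : 0 < ZU) (hM1 : 0 < M1) (hM2 : 0 < M2)
    (hM3 : 0 < M3) (hM4 : 0 < M4) :
    ∃ Nt : ℝ, 0 < Nt ∧
      ∀ (Kc ZL : ℝ), 0 < Kc → 0 < ZL →
      ∀ (W : Set (ℝ × ℝ)), IsOpen W → {pt : ℝ × ℝ | 0 ≤ pt.1} ⊆ W →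
      ∀ u z m c p α β yt qt : ℝ × ℝ → ℝ,
        ContDiffOn ℝ 2 u W → ContDiffOn ℝ 2 z W → ContDiffOn ℝ 2 m W →
        c = (fun pt => Kc * m pt * z pt ^ ((γ + 1) / (γ - 1))) →
        p = (fun pt => ((γ - 1) / (2 * γ) * Kc) * (m pt) ^ 2 * z pt ^ (2 * γ / (γ - 1))) →
        α = (fun pt => pdx u pt + m pt * pdx z pt + ((γ - 1) / γ) * pdx m pt * z pt) →
        β = (fun pt => pdx u pt - m pt * pdx z pt - ((γ - 1) / γ) * pdx m pt * z pt) →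
        yt = (fun pt => z pt ^ ((γ + 1) / (2 * (γ - 1))) * α pt
          + ((γ - 1) / (γ * (3 * γ - 1))) * z pt ^ ((γ + 1) / (2 * (γ - 1)) + 1) * pdx m pt) →
        qt = (fun pt => z pt ^ ((γ + 1) / (2 * (γ - 1))) * β pt
          - ((γ - 1) / (γ * (3 * γ - 1))) * z pt ^ ((γ + 1) / (2 * (γ - 1)) + 1) * pdx m pt) →
        (∀ pt : ℝ × ℝ, 0 ≤ pt.1 → pdt z pt + (c pt / m pt) * pdx u pt = 0) →
        (∀ pt : ℝ × ℝ, 0 ≤ pt.1 →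
          pdt u pt + m pt * c pt * pdx z pt + 2 * (p pt / m pt) * pdx m pt = 0) →
        (∀ pt : ℝ × ℝ, 0 ≤ pt.1 → pdt m pt = 0) →
        (∀ pt : ℝ × ℝ, 0 ≤ pt.1 → ZL < z pt ∧ z pt < ZU ∧ M1 < m pt ∧ m pt < M2 ∧
          |pdx m pt| < M3 ∧ |pdx (pdx m) pt| < M4) →
        ∀ x : ℝ, -Nt ≤ yt (0, x) ∧ -Nt ≤ qt (0, x) := by
  have hγ1 : 0 < γ - 1 := by linarith
  have hγ3 : 0 < 3 * γ - 1 := by linarith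
  have hγ0 : 0 < γ := by linarith
  set e := (γ + 1) / (2 * (γ - 1)) with he
  set k := (γ - 1) / γ with hk
  set d := (γ - 1) / (γ * (3 * γ - 1)) with hd
  have he0 : 0 < e := by positivity
  have hdek : 2 * d * (e + 1) = 1 - k := by
    have h1 : e + 1 = (3 * γ - 1) / (2 * (γ - 1)) := by
      rw [he]
      field_simp
      ring
    have h2 : 3 * γ - 1 ≠ 0 := hγ3.ne'
    rw [h1, hk, hd]
    generalize 3 * γ - 1 = r at h2
    field_simp
    ring
  refine ⟨1 + 4 * ((ZU ^ e * ZU) ^ 2 * (|d| * (M2 * M4) + |(k + d) ^ 2 - k| * M3 ^ 2)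
      + |(k + d) * (e - 1)| * M3 * (ZU ^ e * ZU)) / e, by positivity, ?_⟩
  intro Kc ZL hKc hZL W hW hsub u z m c p α β yt qt hu hz hm hc hp hα hβ hyt hqt hzt hut hmt hb x
  have hz0 : ∀ pt : ℝ × ℝ, 0 ≤ pt.1 → 0 < z pt := fun pt h => hZL.trans (hb pt h).1
  have hm0 : ∀ pt : ℝ × ℝ, 0 ≤ pt.1 → 0 < m pt := fun pt h => hM1.trans (hb pt h).2.2.1
  have hnhds : ∀ pt : ℝ × ℝ, 0 ≤ pt.1 → W ∈ nhds pt := fun pt h => hW.mem_nhds (hsub h)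
  have hc' : ∀ pt : ℝ × ℝ, 0 ≤ pt.1 → c pt = Kc * m pt * (z pt ^ e) ^ 2 := fun pt h => by
    rw [hc, ← Real.rpow_mul_natCast (hz0 pt h).le, he]
    simp only
    congr 2
    push_cast
    field_simp
  have hp' : ∀ pt : ℝ × ℝ, 0 ≤ pt.1 →
      p pt = k / 2 * Kc * m pt ^ 2 * ((z pt ^ e) ^ 2 * z pt) := fun pt h => by
    rw [hp, ← Real.rpow_mul_natCast (hz0 pt h).le, ← Real.rpow_add_one (hz0 pt h).ne', he, hk]
    simp only
    congr 2
    · field_simp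
    · push_cast
      field_simp
      ring
  have key := fun (σ : ℝ) (hσ : σ = 1 ∨ σ = -1) => neg_le_weightedGradient
    (fun pt h => hu.contDiffAt (hnhds pt h)) (fun pt h => hz.contDiffAt (hnhds pt h))
    (fun pt h => hm.contDiffAt (hnhds pt h))
    (fun pt h => by
      have h1 := hzt pt h
      have := (hm0 pt h).ne'
      rw [hc' pt h] at h1
      field_simp at h1
      linarith)
    (fun pt h => by
      have h1 := hut pt h
      have := (hm0 pt h).ne'
      rw [hc' pt h, hp' pt h] at h1
      field_simp at h1
      linarith)
    hmt he0 hdek hσ hKc hZL hM1 hb x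
  constructor
  · refine (key 1 (Or.inl rfl)).trans_eq ?_
    rw [hyt, hα]
    simp only [weightedGradient]
    ring
  · refine (key (-1) (Or.inr rfl)).trans_eq ?_
    rw [hqt, hβ]
    simp only [weightedGradient]
    ring
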